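/- (Adjugate entries of the internal Laplacian block are forest polynomials.) Let G be a Feynman graph with at least one internal vertex, and let L^{ii} be the square matrix indexed by the internal vertices whose diagonal entry at v is Σ_{e incident to v} α_e and whose off-diagonal entry at (u, v) is −Σ_{e joining u and v} α_e. Then for all internal vertices v, w (not necessarily distinct), the (v, w) entry of the adjugate matrix of L^{ii} equals Ψ̃_G^{q(v,w)}, where q(v,w) denotes the collection consisting of the part {v,w} (a singleton if v = w) together with the singletons {m} for every external vertex m. Equivalently, Ψ̃_G · ((L^{ii})^{−1})_{v,w} = Ψ̃_G^{q(v,w)} whenever det L^{ii} ≠ 0. -/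

import Mathlib

open scoped Classical ENNReal
open MeasureTheory

noncomputable section

/-- A Feynman graph with vertices `Fin nV`, edges `Fin nE` (each edge has two
distinct endpoints, multiple edges allowed), a set of external vertices and
real edge weights. -/
structure FeynmanGraph (nV nE : ℕ) where
  ends : Fin nE → Fin nV × Fin nV
  ends_ne : ∀ e, (ends e).1 ≠ (ends e).2
  ext : Finset (Fin nV)
  ν : Fin nE → ℝ

/-- `λ = d/2 - 1`. -/
def lam (d : ℕ) : ℝ := (d : ℝ) / 2 - 1

namespace FeynmanGraph

variable {nV nE : ℕ} (G : FeynmanGraph nV nE)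

/-- The edge `e` is incident to the vertex `v`. -/
def Incident (e : Fin nE) (v : Fin nV) : Prop :=
  (G.ends e).1 = v ∨ (G.ends e).2 = v

/-- The edge `e` joins the vertices `u` and `v`. -/
def Joins (e : Fin nE) (u v : Fin nV) : Prop :=
  G.ends e = (u, v) ∨ G.ends e = (v, u)

/-- The internal vertices of `G`. -/
def intVerts : Finset (Fin nV) := Finset.univ.filter (fun v => v ∉ G.ext)

/-- The simple graph on the vertices of `G` induced by a subset `F` of the edges. -/
def edgeGraph (F : Finset (Fin nE)) : SimpleGraph (Fin nV) :=
  SimpleGraph.fromRel (fun u v => ∃ e ∈ F, G.Joins e u v)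

/-- `F` is a spanning forest of `G` compatible with the collection `p` of pairwise
disjoint vertex sets: `F` is acyclic (as a set of multigraph edges), the graph
`(V, F)` has exactly `p.card` connected components, and distinct parts of `p` lie in
distinct components.  (Acyclicity together with the component count is expressed by
the edge count `F.card + p.card = nV`.) -/
def IsForest (p : Finset (Finset (Fin nV))) (F : Finset (Fin nE)) : Prop :=
  F.card + p.card = nV ∧
  Nat.card (G.edgeGraph F).ConnectedComponent = p.card ∧
  (∀ P ∈ p, ∀ u ∈ P, ∀ v ∈ P, (G.edgeGraph F).Reachable u v) ∧
  (∀ P ∈ p, ∀ Q ∈ p, P ≠ Q → ∀ u ∈ P, ∀ v ∈ Q, ¬ (G.edgeGraph F).Reachable u v)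

/-- The set `𝓕_G^p` of spanning forests compatible with `p`. -/
def forests (p : Finset (Finset (Fin nV))) : Finset (Finset (Fin nE)) :=
  Finset.univ.filter (fun F => G.IsForest p F)

/-- The dual spanning forest polynomial `Ψ̃_G^p`, evaluated at `α`. -/
def dualForestPoly (p : Finset (Finset (Fin nV))) (α : Fin nE → ℝ) : ℝ :=
  ∑ F ∈ G.forests p, ∏ e ∈ F, α e

/-- The spanning forest polynomial `Ψ_G^p`, evaluated at `α`. -/
def forestPoly (p : Finset (Finset (Fin nV))) (α : Fin nE → ℝ) : ℝ :=
  ∑ F ∈ G.forests p, ∏ e ∈ Finset.univ \ F, α e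

/-- The partition of the external vertices into singletons. -/
def singlePart : Finset (Finset (Fin nV)) := G.ext.image (fun v => {v})

/-- The collection `p(i,j)` consisting of `{i, j}` together with the singletons of the
remaining external vertices. -/
def pairPart (i j : Fin nV) : Finset (Finset (Fin nV)) :=
  insert ({i, j} : Finset (Fin nV)) (((G.ext.erase i).erase j).image (fun v => {v}))

/-- `Ψ̃_G`, evaluated at `α`. -/
def psiTilde (α : Fin nE → ℝ) : ℝ := G.dualForestPoly G.singlePart α

/-- `Φ̃_G(α, x) = Σ_{i<j external} ‖x_i - x_j‖² Ψ̃_G^{p(i,j)}(α)`. -/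
def phiTilde {d : ℕ} (x : Fin nV → EuclideanSpace ℝ (Fin d)) (α : Fin nE → ℝ) : ℝ :=
  ∑ i ∈ G.ext, ∑ j ∈ G.ext.filter (fun j => i < j),
    ‖x i - x j‖ ^ 2 * G.dualForestPoly (G.pairPart i j) α

/-- Positions of all vertices: external vertices are placed according to `x`,
internal vertices according to `y`. -/
def assemble {E : Type*} (x : Fin nV → E) (y : {v : Fin nV // v ∉ G.ext} → E) :
    Fin nV → E :=
  fun v => if h : v ∉ G.ext then y ⟨v, h⟩ else x v

/-- The position space Feynman integral
`f_G(x) = ∫ ∏_{v internal} d^d x_v/π^{d/2} ∏_e ‖x_{u(e)} - x_{w(e)}‖^{-2λν_e}`,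
a Lebesgue integral of a nonnegative function, with values in `[0,∞]`.  Only the
external components of `x` matter. -/
def posIntegral (d : ℕ) (x : Fin nV → EuclideanSpace ℝ (Fin d)) : ℝ≥0∞ :=
  (∫⁻ y : {v : Fin nV // v ∉ G.ext} → EuclideanSpace ℝ (Fin d),
      ENNReal.ofReal (∏ e,
        ‖G.assemble x y (G.ends e).1 - G.assemble x y (G.ends e).2‖ ^ (-(2 * lam d * G.ν e)))) /
    ENNReal.ofReal (Real.pi ^ ((d : ℝ) / 2 * (G.intVerts.card : ℝ)))

/-- The standard positions of the three external vertices `0`, `1`, `z`. -/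
def extPos (d : ℕ) (v0 v1 vz : Fin nV) (z : ℂ) : Fin nV → EuclideanSpace ℝ (Fin d) :=
  fun v =>
    if v = v0 then 0
    else if v = v1 then WithLp.toLp 2 (fun i => if (i : ℕ) = 0 then 1 else 0)
    else if v = vz then
      WithLp.toLp 2 (fun i => if (i : ℕ) = 0 then z.re else if (i : ℕ) = 1 then z.im else 0)
    else 0

/-- The graphical function `f_G(z)` of a graph with the three external vertices
`v0`, `v1`, `vz`. -/
def graphicalFn (d : ℕ) (v0 v1 vz : Fin nV) (z : ℂ) : ℝ≥0∞ :=
  G.posIntegral d (extPos d v0 v1 vz z)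

/-- The edges of `G` having both endpoints in `Vg`. -/
def edgesWithin (Vg : Finset (Fin nV)) : Finset (Fin nE) :=
  Finset.univ.filter (fun e => (G.ends e).1 ∈ Vg ∧ (G.ends e).2 ∈ Vg)

/-- Ultraviolet convergence. -/
def UVConvergent (d : ℕ) : Prop :=
  ∀ Vg : Finset (Fin nV), 2 ≤ Vg.card → (Vg ∩ G.ext).card ≤ 1 →
    lam d * ∑ e ∈ G.edgesWithin Vg, G.ν e < (d : ℝ) / 2 * ((Vg.card : ℝ) - 1)

/-- `(Vg, Eg)` is a subgraph of `G`. -/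
def IsSubgraph (Vg : Finset (Fin nV)) (Eg : Finset (Fin nE)) : Prop :=
  ∀ e ∈ Eg, (G.ends e).1 ∈ Vg ∧ (G.ends e).2 ∈ Vg

/-- `v` is a `g`-internal vertex of the subgraph `g = (Vg, Eg)`. -/
def GInternal (Vg : Finset (Fin nV)) (Eg : Finset (Fin nE)) (v : Fin nV) : Prop :=
  v ∉ G.ext ∧ v ∈ Vg ∧ ∀ e, G.Incident e v → e ∈ Eg

/-- The set of `g`-internal vertices of the subgraph `g = (Vg, Eg)`. -/
def gInternalSet (Vg : Finset (Fin nV)) (Eg : Finset (Fin nE)) : Finset (Fin nV) :=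
  Finset.univ.filter (fun v => G.GInternal Vg Eg v)

/-- Infrared convergence. -/
def IRConvergent (d : ℕ) : Prop :=
  ∀ Vg : Finset (Fin nV), ∀ Eg : Finset (Fin nE), G.IsSubgraph Vg Eg →
    0 < (G.gInternalSet Vg Eg).card →
    (∀ e ∈ Eg, G.GInternal Vg Eg (G.ends e).1 ∨ G.GInternal Vg Eg (G.ends e).2) →
    (d : ℝ) / 2 * ((G.gInternalSet Vg Eg).card : ℝ) < lam d * ∑ e ∈ Eg, G.ν e

/-- The superficial degree of divergence `M_G = λ ν_G - (d/2)·V_int`. -/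
def Mdeg (d : ℕ) : ℝ := lam d * ∑ e, G.ν e - (d : ℝ) / 2 * (G.intVerts.card : ℝ)

end FeynmanGraph

namespace FeynmanGraph

variable {nV nE : ℕ} (G : FeynmanGraph nV nE)

/-- The dual spanning forest polynomial `Ψ̃_G^p` as a multivariate polynomial over `ℤ`
in the variables `α_e`, `e ∈ E`. -/
def dualPoly (p : Finset (Finset (Fin nV))) : MvPolynomial (Fin nE) ℤ :=
  ∑ F ∈ G.forests p, ∏ e ∈ F, MvPolynomial.X e

/-- The endpoint of the edge `e` other than `k` (for `e` incident to `k`). -/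
def other (e : Fin nE) (k : Fin nV) : Fin nV :=
  if (G.ends e).1 = k then (G.ends e).2 else (G.ends e).1

/-- The collection `q(v,w)` consisting of the part `{v, w}` (a singleton if `v = w`)
together with the singletons of all external vertices. -/
def qPart (v w : Fin nV) : Finset (Finset (Fin nV)) :=
  insert ({v, w} : Finset (Fin nV)) (G.ext.image (fun m => {m}))

end FeynmanGraph

namespace FeynmanGraph

/-- The internal block `L^{ii}` of the Laplacian matrix of `G`, a matrix indexed by the
internal vertices with polynomial entries: the diagonal entry at `v` is
`Σ_{e incident to v} α_e` and the off-diagonal entry at `(u,v)` is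
`-Σ_{e joining u and v} α_e`. -/
def Lii {nV nE : ℕ} (G : FeynmanGraph nV nE) :
    Matrix {v : Fin nV // v ∉ G.ext} {v : Fin nV // v ∉ G.ext} (MvPolynomial (Fin nE) ℤ) :=
  fun u v =>
    if u = v then ∑ e ∈ Finset.univ.filter (fun e => G.Incident e v), MvPolynomial.X e
    else - ∑ e ∈ Finset.univ.filter (fun e => G.Joins e u v), MvPolynomial.X e

end FeynmanGraph

namespace Matrix

variable {V K : Type*} [DecidableEq V] [CommRing K]

/-- The matrix whose rows are `e_u - e_{g u}` for `u ∉ R`, `e_u` for `u ∈ R \ {w}` and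
`e_v` for `u = w`. -/
def flowMatrix (K : Type*) [CommRing K] (g : V → V) (R : Finset V) (v w : V) : Matrix V V K :=
  fun u => if u = w then Pi.single v 1 else if u ∈ R then Pi.single u 1
    else Pi.single u 1 - Pi.single (g u) 1

theorem flowMatrix_row_of_notMem {g : V → V} {R : Finset V} {v w : V} (hw : w ∈ R) {u : V}
    (hu : u ∉ R) : flowMatrix K g R v w u = Pi.single u 1 - Pi.single (g u) 1 := by
  have : u ≠ w := (ne_of_mem_of_not_mem hw hu).symm
  simp [flowMatrix, this, hu]

variable [Fintype V]

theorem det_updateRow_sub (M : Matrix V V K) (j : V) (x y : V → K) :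
    det (updateRow M j (x - y)) = det (updateRow M j x) - det (updateRow M j y) :=
  (detRowAlternating : (V → K) [⋀^V]→ₗ[K] K).map_update_sub M j x y

/-- If row `u` of `M` is `e_u - e_x` then `e_u` and `e_x` are interchangeable in any other row. -/
theorem det_updateRow_single_eq {M : Matrix V V K} {u x j : V} (hj : u ≠ j)
    (hu : M u = Pi.single u 1 - Pi.single x 1) :
    (M.updateRow j (Pi.single u 1)).det = (M.updateRow j (Pi.single x 1)).det := by
  have h := det_updateRow_eq_zero (M := M) hj
  rwa [hu, det_updateRow_sub, sub_eq_zero] at h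

/-- The flow matrix with `v = w` is unitriangular if every vertex flows to `R`. -/
theorem det_flowMatrix_self {g : V → V} {R : Finset V} {w : V} (hw : w ∈ R)
    (hR : ∀ u, ∃ n, g^[n] u ∈ R) : (flowMatrix K g R w w).det = 1 := by
  have hlt : ∀ u, u ∉ R → Nat.find (hR (g u)) < Nat.find (hR u) := by
    intro u hu
    obtain ⟨n, hn⟩ : ∃ n, Nat.find (hR u) = n + 1 := by
      refine Nat.exists_eq_succ_of_ne_zero fun h0 => hu ?_
      simpa [h0] using Nat.find_spec (hR u)
    have hs := Nat.find_spec (hR u)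
    rw [hn, Function.iterate_succ_apply] at hs
    have := Nat.find_min' (hR (g u)) hs
    omega
  have hentry : ∀ u x, Nat.find (hR u) ≤ Nat.find (hR x) →
      flowMatrix K g R w w u x = (1 : Matrix V V K) u x := by
    intro u x hux
    by_cases hu : u ∈ R
    · by_cases huw : u = w <;> simp [flowMatrix, huw, hu, one_apply, Pi.single_apply, eq_comm]
    · have hx : x ≠ g u := by
        rintro rfl
        exact absurd (hlt u hu) (by omega)
      rw [flowMatrix_row_of_notMem hw hu]
      simp [one_apply, Pi.single_apply, hx, eq_comm]
  have htri : BlockTriangular (flowMatrix K g R w w)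
      (fun u => OrderDual.toDual (Nat.find (hR u))) := by
    intro u x hux
    have hux' : Nat.find (hR u) < Nat.find (hR x) := hux
    rw [hentry u x hux'.le, one_apply_ne]
    rintro rfl
    exact lt_irrefl _ hux'
  rw [htri.det]
  refine Finset.prod_eq_one fun a _ => ?_
  rw [← det_one (n := {u // OrderDual.toDual (Nat.find (hR u)) = a}) (R := K)]
  congr 1
  ext u x
  have hux : Nat.find (hR u) ≤ Nat.find (hR x) :=
    (OrderDual.toDual.injective (u.2.trans x.2.symm)).le
  rw [toSquareBlock_def, of_apply, hentry u x hux]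
  simp [one_apply, Subtype.ext_iff]

theorem det_flowMatrix_eq_zero_of_not_reach {g : V → V} {R : Finset V} {v w u : V} (hw : w ∈ R)
    (hu : ∀ n, g^[n] u ∉ R) : (flowMatrix K g R v w).det = 0 := by
  obtain ⟨i, j, hij, he⟩ := Finite.exists_ne_map_eq_of_infinite fun n => g^[n] u
  obtain ⟨c, hc, m, hm⟩ : ∃ c, (∀ n, g^[n] c ∉ R) ∧ ∃ m, g^[m + 1] c = c := by
    wlog hlt : i < j generalizing i j
    · exact this j i hij.symm he.symm (by omega)
    refine ⟨g^[i] u, fun n => ?_, j - i - 1, ?_⟩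
    · rw [← Function.iterate_add_apply]
      exact hu _
    · rw [← Function.iterate_add_apply, show j - i - 1 + 1 + i = j by omega]
      exact he.symm
  set M := flowMatrix K g R v w
  have hconst : ∀ n, (M.updateRow c (Pi.single (g^[n + 1] c) 1)).det =
      (M.updateRow c (Pi.single (g c) 1)).det := by
    intro n
    induction n with
    | zero => rfl
    | succ n ih =>
      rw [Function.iterate_succ_apply' g (n + 1)]
      by_cases h : g^[n + 1] c = c
      · rw [h]
      · rw [← ih]
        exact (det_updateRow_single_eq h (flowMatrix_row_of_notMem hw (hc _))).symm
  have hrow : M c = Pi.single c 1 - Pi.single (g c) 1 := flowMatrix_row_of_notMem hw (hc 0)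
  rw [← updateRow_eq_self M c, hrow, det_updateRow_sub, ← hconst m, hm, sub_self]

theorem det_flowMatrix {g : V → V} {R : Finset V} {v w : V} (hw : w ∈ R)
    (hg : ∀ r ∈ R, g r = r) :
    (flowMatrix K g R v w).det =
      if (∀ u, ∃ n, g^[n] u ∈ R) ∧ ∃ n, g^[n] v = w then 1 else 0 := by
  by_cases hR : ∀ u, ∃ n, g^[n] u ∈ R
  swap
  · rw [if_neg fun h => hR h.1]
    push Not at hR
    obtain ⟨u, hu⟩ := hR
    exact det_flowMatrix_eq_zero_of_not_reach hw hu
  have hupd : ∀ x, flowMatrix K g R x w =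
      (flowMatrix K g R w w).updateRow w (Pi.single x 1) := by
    intro x
    ext u y
    by_cases hu : u = w
    · subst hu; simp [flowMatrix]
    · simp [flowMatrix, hu]
  have hstep : ∀ x, (flowMatrix K g R (g x) w).det = (flowMatrix K g R x w).det := by
    intro x
    by_cases hx : x ∈ R
    · rw [hg x hx]
    · rw [hupd, hupd x]
      exact (det_updateRow_single_eq (ne_of_mem_of_not_mem hw hx).symm
        (flowMatrix_row_of_notMem hw hx)).symm
  have hiter : ∀ n x, (flowMatrix K g R (g^[n] x) w).det = (flowMatrix K g R x w).det := by
    intro n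
    induction n with
    | zero => intro x; rfl
    | succ n ih => intro x; rw [Function.iterate_succ_apply, ih, hstep]
  split_ifs with h
  · obtain ⟨n, hn⟩ := h.2
    rw [← hiter n, hn, det_flowMatrix_self hw hR]
  · obtain ⟨n, hn⟩ := hR v
    have hne : g^[n] v ≠ w := fun he => h ⟨hR, n, he⟩
    rw [← hiter n, hupd]
    have hrow : flowMatrix K g R w w (g^[n] v) = Pi.single (g^[n] v) 1 := by
      simp [flowMatrix, hne, hn]
    rw [← hrow]
    exact det_updateRow_eq_zero hne

end Matrix

namespace FeynmanGraph

variable {nV nE : ℕ} {G : FeynmanGraph nV nE}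

theorem Incident.joins_other {e : Fin nE} {u : Fin nV} (h : G.Incident e u) :
    G.Joins e u (G.other e u) := by
  unfold Joins other
  by_cases h1 : (G.ends e).1 = u
  · simp [h1, Prod.ext_iff]
  · have h2 := h.resolve_left h1
    simp [h1, h2, Prod.ext_iff]

theorem Joins.symm {e : Fin nE} {u x : Fin nV} (h : G.Joins e u x) : G.Joins e x u :=
  Or.symm h

theorem Joins.incident {e : Fin nE} {u x : Fin nV} (h : G.Joins e u x) : G.Incident e u := by
  rcases h with h | h <;> simp [Incident, h]

theorem Joins.ne {e : Fin nE} {u x : Fin nV} (h : G.Joins e u x) : u ≠ x := by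
  have := G.ends_ne e
  rcases h with h | h <;> rw [h] at this
  exacts [this, this.symm]

theorem Joins.other_eq {e : Fin nE} {u x : Fin nV} (h : G.Joins e u x) : G.other e u = x := by
  have hne := h.ne
  rcases h with h | h <;> simp [other, h, hne.symm]

theorem joins_iff {e : Fin nE} {u x : Fin nV} :
    G.Joins e u x ↔ G.Incident e u ∧ G.other e u = x :=
  ⟨fun h => ⟨h.incident, h.other_eq⟩, fun h => h.2 ▸ h.1.joins_other⟩

theorem edgeGraph_adj {F : Finset (Fin nE)} {u x : Fin nV} :
    (G.edgeGraph F).Adj u x ↔ ∃ e ∈ F, G.Joins e u x := by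
  rw [edgeGraph, SimpleGraph.fromRel_adj]
  constructor
  · rintro ⟨-, h | ⟨e, he, h⟩⟩
    exacts [h, ⟨e, he, h.symm⟩]
  · rintro ⟨e, he, h⟩
    exact ⟨h.ne, Or.inl ⟨e, he, h⟩⟩

variable (G) in
/-- Move from `u` along the edge chosen by `f`, staying at `u` if no edge is chosen. -/
def step (f : Fin nV → Option (Fin nE)) (u : Fin nV) : Fin nV :=
  (f u).elim u (fun e => G.other e u)

/-- The set of edges chosen by `f`. -/
def chosen (f : Fin nV → Option (Fin nE)) : Finset (Fin nE) :=
  Finset.univ.filter fun e => ∃ u, f u = some e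

variable (G) in
/-- The options of the vertex `u`: an incident edge if `u ∉ R`, no edge if `u ∈ R`. -/
def options (R : Finset (Fin nV)) (u : Fin nV) : Finset (Option (Fin nE)) :=
  if u ∈ R then {none} else (Finset.univ.filter fun e => G.Incident e u).map .some

variable (G) in
/-- The function `f` selects at every vertex outside `R` an incident edge, such that following
the selected edges leads every vertex to `R`. -/
structure IsFlow (R : Finset (Fin nV)) (f : Fin nV → Option (Fin nE)) : Prop where
  mem_options : ∀ u, f u ∈ G.options R u
  reach : ∀ u, ∃ n, (G.step f)^[n] u ∈ R

variable (G) in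
/-- `F` is a spanning forest each of whose components contains exactly one element of `R`. -/
structure IsRooted (R : Finset (Fin nV)) (F : Finset (Fin nE)) : Prop where
  card_add : F.card + R.card = nV
  reach : ∀ u, ∃ r ∈ R, (G.edgeGraph F).Reachable u r
  eq_of_reachable : ∀ r ∈ R, ∀ s ∈ R, (G.edgeGraph F).Reachable r s → r = s

variable {R : Finset (Fin nV)} {f f' : Fin nV → Option (Fin nE)} {u x : Fin nV} {e : Fin nE}

theorem step_of_eq_some (h : f u = some e) : G.step f u = G.other e u := by
  simp [step, h]

theorem mem_chosen : e ∈ chosen f ↔ ∃ u, f u = some e := by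
  simp [chosen]

theorem eq_none_of_mem_options (hf : f u ∈ G.options R u) (hu : u ∈ R) : f u = none := by
  simpa [options, hu] using hf

theorem exists_of_mem_options (hf : f u ∈ G.options R u) (hu : u ∉ R) :
    ∃ e, f u = some e ∧ G.Incident e u := by
  simp only [options, hu, if_false, Finset.mem_map, Finset.mem_filter, Finset.mem_univ,
    true_and] at hf
  obtain ⟨e, he, h⟩ := hf
  exact ⟨e, h.symm, he⟩

theorem notMem_of_eq_some (hf : f u ∈ G.options R u) (h : f u = some e) : u ∉ R := by
  intro hu
  simp [eq_none_of_mem_options hf hu] at h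

theorem joins_step (hf : f u ∈ G.options R u) (h : f u = some e) :
    G.Joins e u (G.step f u) := by
  obtain ⟨e', he', hi⟩ := exists_of_mem_options hf (notMem_of_eq_some hf h)
  obtain rfl : e' = e := Option.some_injective _ (he'.symm.trans h)
  rw [step_of_eq_some h]
  exact hi.joins_other

theorem step_of_mem (hf : f u ∈ G.options R u) (hu : u ∈ R) : G.step f u = u := by
  simp [step, eq_none_of_mem_options hf hu]

/-- A set of vertices outside `R` cannot be closed under the steps of a flow. -/
theorem IsFlow.false_of_closed (hf : G.IsFlow R f) {P : Fin nV → Prop} (hu : P u)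
    (hR : ∀ x, P x → x ∉ R) (hP : ∀ x, P x → P (G.step f x)) : False := by
  obtain ⟨n, hn⟩ := hf.reach u
  have hiter : ∀ m, P ((G.step f)^[m] u) := by
    intro m
    induction m with
    | zero => exact hu
    | succ m ih => exact Function.iterate_succ_apply' (G.step f) m u ▸ hP _ ih
  exact hR _ (hiter n) hn

theorem IsFlow.eq_of_eq_some (hf : G.IsFlow R f) (hu : f u = some e) (hx : f x = some e) :
    u = x := by
  by_contra hne
  have ju := joins_step (hf.mem_options u) hu
  have jx := joins_step (hf.mem_options x) hx
  have key : G.step f u = x ∧ G.step f x = u := by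
    rcases ju with h1 | h1 <;> rcases jx with h2 | h2 <;>
      simp only [h1, Prod.mk.injEq] at h2 <;> grind
  refine hf.false_of_closed (u := u) (P := fun y => y = u ∨ y = x) (Or.inl rfl) ?_ ?_
  · rintro y (rfl | rfl)
    exacts [notMem_of_eq_some (hf.mem_options _) hu, notMem_of_eq_some (hf.mem_options _) hx]
  · rintro y (rfl | rfl)
    exacts [Or.inr key.1, Or.inl key.2]

/-- Choosing edges is a bijection from the vertices outside `R` to the chosen edges. -/
theorem IsFlow.prod_chosen (hf : G.IsFlow R f) {K : Type*} [CommMonoid K] (c : Fin nE → K) :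
    ∏ u, (f u).elim 1 c = ∏ e ∈ chosen f, c e := by
  have : ∀ u ∈ Finset.univ, u ∉ Rᶜ → (f u).elim 1 c = 1 := by
    intro u _ hu
    rw [eq_none_of_mem_options (hf.mem_options u) (by simpa using hu)]
    rfl
  rw [← Finset.prod_subset (Finset.subset_univ Rᶜ) this]
  have hsome : ∀ u ∈ Rᶜ, ∃ e, f u = some e := fun u hu =>
    (exists_of_mem_options (hf.mem_options u) (Finset.mem_compl.1 hu)).imp fun _ h => h.1
  choose i hi using hsome
  refine Finset.prod_bij i (fun u hu => mem_chosen.2 ⟨u, hi u hu⟩) ?_ ?_ ?_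
  · intro u hu x hx h
    exact hf.eq_of_eq_some (hi u hu) (h ▸ hi x hx)
  · intro e he
    obtain ⟨u, hu⟩ := mem_chosen.1 he
    have huR := Finset.mem_compl.2 (notMem_of_eq_some (hf.mem_options u) hu)
    exact ⟨u, huR, Option.some_injective _ ((hi u huR).symm.trans hu)⟩
  · intro u hu
    rw [hi u hu]
    rfl

theorem IsFlow.card_chosen (hf : G.IsFlow R f) : (chosen f).card + R.card = nV := by
  have h : ∏ u, (f u).elim 1 (fun _ => 2) = ∏ _e ∈ chosen f, 2 := hf.prod_chosen _
  have hR : ∀ u, (f u).elim 1 (fun _ => 2) = if u ∈ Rᶜ then 2 else 1 := by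
    intro u
    by_cases hu : u ∈ R
    · simp [eq_none_of_mem_options (hf.mem_options u) hu, hu]
    · obtain ⟨e, he, -⟩ := exists_of_mem_options (hf.mem_options u) hu
      simp [he, hu]
  simp only [hR, Finset.prod_ite_mem, Finset.univ_inter, Finset.prod_const] at h
  rw [← Nat.pow_right_injective le_rfl h, Finset.card_compl_add_card, Fintype.card_fin]

theorem reachable_iterate_step (hf : ∀ u, f u ∈ G.options R u) (u : Fin nV) (n : ℕ) :
    (G.edgeGraph (chosen f)).Reachable u ((G.step f)^[n] u) := by
  induction n with
  | zero => exact SimpleGraph.Reachable.refl _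
  | succ n ih =>
    rw [Function.iterate_succ_apply']
    refine ih.trans ?_
    set y := (G.step f)^[n] u
    by_cases hy : y ∈ R
    · rw [step_of_mem (hf y) hy]
    · obtain ⟨e, he, -⟩ := exists_of_mem_options (hf y) hy
      exact (edgeGraph_adj.2 ⟨e, mem_chosen.2 ⟨y, he⟩, joins_step (hf y) he⟩).reachable

theorem iterate_step_of_mem (hf : f u ∈ G.options R u) (hu : u ∈ R) (n : ℕ) :
    (G.step f)^[n] u = u :=
  Function.iterate_fixed (step_of_mem hf hu) n

/-- The vertices connected by chosen edges flow to the same roots. -/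
theorem iterate_step_of_reachable (hf : ∀ u, f u ∈ G.options R u) {r : Fin nV} (hr : r ∈ R)
    (h : (G.edgeGraph (chosen f)).Reachable u x) (hu : ∃ n, (G.step f)^[n] u = r) :
    ∃ n, (G.step f)^[n] x = r := by
  have hstep : ∀ y, (∃ n, (G.step f)^[n] (G.step f y) = r) ↔ ∃ n, (G.step f)^[n] y = r := by
    refine fun y => ⟨fun ⟨n, hn⟩ => ⟨n + 1, hn⟩, ?_⟩
    rintro ⟨n, rfl⟩
    refine ⟨n, ?_⟩
    rw [← Function.iterate_succ_apply, Function.iterate_succ_apply',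
      step_of_mem (hf _) hr]
  obtain ⟨p⟩ := h
  induction p with
  | nil => exact hu
  | @cons a b _ hab _ ih =>
    refine ih ?_
    obtain ⟨e, he, hj⟩ := edgeGraph_adj.1 hab
    obtain ⟨y, hy⟩ := mem_chosen.1 he
    have hs := joins_step (hf y) hy
    have key : (y = a ∧ G.step f y = b) ∨ (y = b ∧ G.step f y = a) := by
      rcases hs with h1 | h1 <;> rcases hj with h2 | h2 <;>
        simp only [h1, Prod.mk.injEq] at h2 <;> grind
    rcases key with ⟨rfl, rfl⟩ | ⟨rfl, rfl⟩
    · exact (hstep _).2 hu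
    · exact (hstep _).1 hu

theorem reachable_iff_iterate_step (hf : ∀ u, f u ∈ G.options R u) {r : Fin nV} (hr : r ∈ R) :
    (G.edgeGraph (chosen f)).Reachable u r ↔ ∃ n, (G.step f)^[n] u = r :=
  ⟨fun h => iterate_step_of_reachable hf hr h.symm ⟨0, rfl⟩,
    fun ⟨n, hn⟩ => hn ▸ reachable_iterate_step hf u n⟩

theorem IsFlow.isRooted (hf : G.IsFlow R f) : G.IsRooted R (chosen f) where
  card_add := hf.card_chosen
  reach u := by
    obtain ⟨n, hn⟩ := hf.reach u
    exact ⟨_, hn, reachable_iterate_step hf.mem_options u n⟩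
  eq_of_reachable r hr s hs h := by
    obtain ⟨n, hn⟩ := (reachable_iff_iterate_step hf.mem_options hs).1 h
    rwa [iterate_step_of_mem (hf.mem_options r) hr] at hn

theorem IsFlow.eq_of_chosen_eq (hf : G.IsFlow R f) (hf' : G.IsFlow R f')
    (h : chosen f = chosen f') : f = f' := by
  by_contra hne
  obtain ⟨u, hu⟩ := Function.ne_iff.1 hne
  have hR : ∀ y, f y ≠ f' y → y ∉ R := fun y hy hyR => hy <| by
    rw [eq_none_of_mem_options (hf.mem_options y) hyR,
      eq_none_of_mem_options (hf'.mem_options y) hyR]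
  refine hf'.false_of_closed (P := fun y => f y ≠ f' y) hu hR fun y hy => ?_
  obtain ⟨e, he, -⟩ := exists_of_mem_options (hf'.mem_options y) (hR y hy)
  obtain ⟨z, hz⟩ : ∃ z, f z = some e := mem_chosen.1 (h ▸ mem_chosen.2 ⟨y, he⟩)
  have hzy : z ≠ y := by
    rintro rfl
    exact hy (hz.trans he.symm)
  have jz := joins_step (hf.mem_options z) hz
  have jy := joins_step (hf'.mem_options y) he
  have key : G.step f' y = z := by
    rcases jz with h1 | h1 <;> rcases jy with h2 | h2 <;>
      simp only [h1, Prod.mk.injEq] at h2 <;> grind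
  rw [key]
  intro hzz
  exact hzy (hf'.eq_of_eq_some (hzz ▸ hz) he)

theorem IsRooted.exists_isFlow {F : Finset (Fin nE)} (hF : G.IsRooted R F) :
    ∃ f, G.IsFlow R f ∧ chosen f = F := by
  have hex : ∀ u, ∃ n, ∃ r ∈ R, ∃ p : (G.edgeGraph F).Walk u r, p.length = n := by
    intro u
    obtain ⟨r, hr, ⟨p⟩⟩ := hF.reach u
    exact ⟨_, r, hr, p, rfl⟩
  have hdesc : ∀ u, u ∉ R → ∃ e ∈ F, G.Incident e u ∧
      Nat.find (hex (G.other e u)) < Nat.find (hex u) := by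
    intro u hu
    obtain ⟨r, hr, p, hp⟩ := Nat.find_spec (hex u)
    cases p with
    | nil => exact absurd hr hu
    | cons h q =>
      obtain ⟨e, he, hj⟩ := edgeGraph_adj.1 h
      refine ⟨e, he, hj.incident, ?_⟩
      rw [← hp, hj.other_eq, SimpleGraph.Walk.length_cons, Nat.lt_succ_iff]
      exact Nat.find_min' _ ⟨r, hr, q, rfl⟩
  choose φ hφF hφi hφd using hdesc
  set f : Fin nV → Option (Fin nE) := fun u => if h : u ∈ R then none else some (φ u h) with hfdef
  have hfs : ∀ u (h : u ∉ R), f u = some (φ u h) := fun u h => by simp [hfdef, h]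
  have hflow : G.IsFlow R f := by
    refine ⟨fun u => ?_, fun u => ?_⟩
    · by_cases hu : u ∈ R
      · simp [options, hu, hfdef]
      · simp [options, hu, hfs u hu, hφi u hu]
    · induction hn : Nat.find (hex u) using Nat.strong_induction_on generalizing u with
      | _ n ih =>
        by_cases hu : u ∈ R
        · exact ⟨0, hu⟩
        · obtain ⟨m, hm⟩ := ih _ (hn ▸ hφd u hu) _ rfl
          refine ⟨m + 1, ?_⟩
          rwa [Function.iterate_succ_apply, step_of_eq_some (hfs u hu)]
  refine ⟨f, hflow, Finset.eq_of_subset_of_card_le ?_ ?_⟩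
  · intro e he
    obtain ⟨u, hu⟩ := mem_chosen.1 he
    have huR := notMem_of_eq_some (hflow.mem_options u) hu
    rw [hfs u huR] at hu
    exact Option.some_injective _ hu ▸ hφF u huR
  · have h1 := hflow.card_chosen
    have h2 := hF.card_add
    omega

theorem mem_qPart {v w : Fin nV} {P : Finset (Fin nV)} :
    P ∈ G.qPart v w ↔ P = {v, w} ∨ ∃ m ∈ G.ext, P = {m} := by
  simp [qPart, eq_comm]

theorem card_qPart {v w : Fin nV} (hv : v ∉ G.ext) (hw : w ∉ G.ext) :
    (G.qPart v w).card = (insert w G.ext).card := by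
  rw [qPart, Finset.card_insert_of_notMem, Finset.card_insert_of_notMem hw,
    Finset.card_image_of_injective _ Finset.singleton_injective]
  rw [Finset.mem_image]
  rintro ⟨m, hm, h⟩
  have : v ∈ ({m} : Finset (Fin nV)) := h ▸ Finset.mem_insert_self _ _
  exact hv (Finset.mem_singleton.1 this ▸ hm)

/-- If the elements of `R` lie in distinct components, then there are `R.card` components if and
only if every component meets `R`. -/
theorem _root_.SimpleGraph.natCard_connectedComponent_eq_iff {V : Type*} [Finite V]
    {H : SimpleGraph V} {R : Finset V} (hR : ∀ r ∈ R, ∀ s ∈ R, H.Reachable r s → r = s) :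
    Nat.card H.ConnectedComponent = R.card ↔ ∀ u, ∃ r ∈ R, H.Reachable u r := by
  have hinj : Function.Injective fun r : R => H.connectedComponentMk r := fun r s h =>
    Subtype.ext (hR r r.2 s s.2 (SimpleGraph.ConnectedComponent.exact h))
  have hcard : Nat.card R = R.card := by simp
  rw [← hcard]
  constructor
  · intro h u
    obtain ⟨r, hr⟩ := (hinj.bijective_of_nat_card_le h.le).2 (H.connectedComponentMk u)
    exact ⟨r, r.2, (SimpleGraph.ConnectedComponent.exact hr).symm⟩
  · intro h
    refine (Nat.card_congr (Equiv.ofBijective _ ⟨hinj, fun c => ?_⟩)).symm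
    induction c using SimpleGraph.ConnectedComponent.ind with
    | _ u =>
      obtain ⟨r, hr, hur⟩ := h u
      exact ⟨⟨r, hr⟩, SimpleGraph.ConnectedComponent.sound hur.symm⟩

theorem isForest_qPart_iff {v w : Fin nV} (hv : v ∉ G.ext) (hw : w ∉ G.ext)
    {F : Finset (Fin nE)} :
    G.IsForest (G.qPart v w) F ↔
      G.IsRooted (insert w G.ext) F ∧ (G.edgeGraph F).Reachable v w := by
  rw [IsForest, card_qPart hv hw]
  constructor
  · rintro ⟨hF, hcc, hconn, hsep⟩
    have hpart : ∀ r ∈ insert w G.ext, ∃ P ∈ G.qPart v w, r ∈ P ∧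
        ∀ s ∈ insert w G.ext, s ∈ P → s = r := by
      intro r hr
      rcases Finset.mem_insert.1 hr with rfl | hr
      · refine ⟨{v, r}, mem_qPart.2 (Or.inl rfl), by simp, fun s hs hsP => ?_⟩
        grind
      · exact ⟨{r}, mem_qPart.2 (Or.inr ⟨r, hr, rfl⟩), by simp, by simp⟩
    have hroot : ∀ r ∈ insert w G.ext, ∀ s ∈ insert w G.ext,
        (G.edgeGraph F).Reachable r s → r = s := by
      intro r hr s hs h
      obtain ⟨P, hP, hrP, huniq⟩ := hpart r hr
      obtain ⟨Q, hQ, hsQ, -⟩ := hpart s hs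
      by_contra hne
      refine hsep P hP Q hQ ?_ r hrP s hsQ h
      rintro rfl
      exact hne (huniq s hs hsQ).symm
    exact ⟨⟨hF, (SimpleGraph.natCard_connectedComponent_eq_iff hroot).1 hcc, hroot⟩,
      hconn {v, w} (mem_qPart.2 (Or.inl rfl)) v (by simp) w (by simp)⟩
  · rintro ⟨hF, hvw⟩
    have hpart : ∀ P ∈ G.qPart v w, ∀ u ∈ P, ∃ r ∈ insert w G.ext,
        (G.edgeGraph F).Reachable u r ∧ ((r = w ∧ P = {v, w}) ∨ (r ∈ G.ext ∧ P = {r})) := by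
      intro P hP u hu
      rcases mem_qPart.1 hP with rfl | ⟨m, hm, rfl⟩
      · refine ⟨w, by simp, ?_, Or.inl ⟨rfl, rfl⟩⟩
        rcases Finset.mem_insert.1 hu with rfl | hu
        · exact hvw
        · rw [Finset.mem_singleton.1 hu]
      · refine ⟨m, by simp [hm], ?_, Or.inr ⟨hm, rfl⟩⟩
        rw [Finset.mem_singleton.1 hu]
    refine ⟨hF.card_add,
      (SimpleGraph.natCard_connectedComponent_eq_iff hF.eq_of_reachable).2 hF.reach, ?_, ?_⟩
    · intro P hP x hx y hy
      obtain ⟨r, hr, hxr, h⟩ := hpart P hP x hx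
      obtain ⟨s, hs, hys, h'⟩ := hpart P hP y hy
      have : r = s := by grind
      exact hxr.trans (this ▸ hys.symm)
    · intro P hP Q hQ hPQ x hx y hy hxy
      obtain ⟨r, hr, hxr, h⟩ := hpart P hP x hx
      obtain ⟨s, hs, hys, h'⟩ := hpart Q hQ y hy
      have : r = s := hF.eq_of_reachable r hr s hs (hxr.symm.trans (hxy.trans hys))
      grind

variable (G) in
/-- The Laplacian matrix of `G` on all vertices, with the rows of the external vertices
replaced by unit vectors and the row of `w` replaced by the unit vector of `v`. -/
def borderedLaplacian (v w : Fin nV) : Matrix (Fin nV) (Fin nV) (MvPolynomial (Fin nE) ℤ) :=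
  fun u => if u = w then Pi.single v 1 else if u ∈ G.ext then Pi.single u 1
    else ∑ e ∈ Finset.univ.filter (fun e => G.Incident e u),
      (MvPolynomial.X e : MvPolynomial (Fin nE) ℤ) • (Pi.single u 1 - Pi.single (G.other e u) 1)

theorem adjugate_Lii_eq_det (v w : {v : Fin nV // v ∉ G.ext}) :
    G.Lii.adjugate v w = (G.borderedLaplacian v w).det := by
  have hext : ∀ m, m ∈ G.ext → G.borderedLaplacian v w m = Pi.single m 1 := by
    intro m hm
    simp [borderedLaplacian, hm, ne_of_mem_of_not_mem hm w.2]
  rw [Matrix.adjugate_apply, Matrix.twoBlockTriangular_det _ (fun u => u ∉ G.ext)]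
  · have hone : (Matrix.toSquareBlockProp (G.borderedLaplacian v w) fun u => ¬u ∉ G.ext) = 1 := by
      ext m x : 1
      rw [Matrix.toSquareBlockProp_def, Matrix.of_apply, hext m (not_not.1 m.2)]
      simp [Matrix.one_apply, Pi.single_apply, Subtype.ext_iff, eq_comm]
    rw [hone, Matrix.det_one, mul_one]
    congr 1
    ext u x : 1
    rw [Matrix.toSquareBlockProp_def, Matrix.of_apply]
    by_cases huw : u = w
    · subst huw
      simp [borderedLaplacian, Pi.single_apply, Subtype.ext_iff]
    · have huw' : (u : Fin nV) ≠ w := fun h => huw (Subtype.ext h)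
      rw [Matrix.updateRow_ne huw]
      simp only [borderedLaplacian, huw', u.2, if_false, Finset.sum_apply, Pi.smul_apply,
        Pi.sub_apply, smul_eq_mul]
      by_cases hux : u = x
      · subst hux
        rw [Lii, if_pos rfl]
        refine Finset.sum_congr rfl fun e he => ?_
        have hne := (Finset.mem_filter.1 he).2.joins_other.ne
        simp [hne]
      · have hux' : (x : Fin nV) ≠ u := fun h => hux (Subtype.ext h.symm)
        rw [Lii, if_neg hux, ← Finset.sum_neg_distrib]
        simp only [joins_iff, ← Finset.filter_filter]
        rw [Finset.sum_filter]
        refine Finset.sum_congr rfl fun e _ => ?_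
        by_cases hx : G.other e u = x
        · simp [hx, hux']
        · simp [hx, hux', Ne.symm hx]
  · intro m hm x hx
    rw [hext m (not_not.1 hm), Pi.single_eq_of_ne]
    rintro rfl
    exact hm hx

/-- Expansion of the determinant along the choice of one incident edge in each row. -/
theorem det_borderedLaplacian (v w : Fin nV) :
    (G.borderedLaplacian v w).det =
      ∑ f ∈ Fintype.piFinset (G.options (insert w G.ext)),
        (∏ u, (f u).elim 1 MvPolynomial.X) *
          (Matrix.flowMatrix _ (G.step f) (insert w G.ext) v w).det := by
  have hrow : G.borderedLaplacian v w = fun u => ∑ o ∈ G.options (insert w G.ext) u,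
      o.elim (Pi.single (if u = w then v else u) 1) fun e =>
        (MvPolynomial.X e : MvPolynomial (Fin nE) ℤ) •
          (Pi.single u 1 - Pi.single (G.other e u) 1) := by
    funext u
    by_cases huw : u = w
    · simp [borderedLaplacian, options, huw]
    · by_cases hu : u ∈ G.ext <;> simp [borderedLaplacian, options, huw, hu]
  rw [hrow]
  refine (MultilinearMap.map_sum_finset Matrix.detRowAlternating.toMultilinearMap _ _).trans ?_
  refine Finset.sum_congr rfl fun f hf => ?_
  rw [Fintype.mem_piFinset] at hf
  rw [← smul_eq_mul]
  refine Eq.trans ?_ (MultilinearMap.map_smul_univ Matrix.detRowAlternating.toMultilinearMap _ _)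
  congr 1
  funext u
  by_cases hu : u ∈ insert w G.ext
  · rw [eq_none_of_mem_options (hf u) hu]
    by_cases huw : u = w
    · simp [Matrix.flowMatrix, huw]
    · simp [Matrix.flowMatrix, huw, hu]
  · obtain ⟨e, he, -⟩ := exists_of_mem_options (hf u) hu
    rw [Matrix.flowMatrix_row_of_notMem (Finset.mem_insert_self _ _) hu, step_of_eq_some he, he]
    rfl

end FeynmanGraph

/-- The entries of the adjugate of the internal Laplacian block are
dual spanning forest polynomials: for all internal vertices `v`, `w`,
`(adjugate L^{ii})_{v,w} = Ψ̃_G^{q(v,w)}`. -/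
theorem adjugate_Lii_eq_forestPoly {nV nE : ℕ} (G : FeynmanGraph nV nE)
    (hint : G.intVerts.Nonempty)
    (v w : {v : Fin nV // v ∉ G.ext}) :
    G.Lii.adjugate v w = G.dualPoly (G.qPart v w) := by
  set R := insert (w : Fin nV) G.ext with hR
  have hwR : (w : Fin nV) ∈ R := Finset.mem_insert_self _ _
  rw [FeynmanGraph.adjugate_Lii_eq_det, FeynmanGraph.det_borderedLaplacian, ← hR,
    FeynmanGraph.dualPoly]
  have hdet : ∀ f ∈ Fintype.piFinset (G.options R),
      (∏ u, (f u).elim 1 MvPolynomial.X) * (Matrix.flowMatrix _ (G.step f) R v w).det =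
        if G.IsFlow R f ∧ (G.edgeGraph (FeynmanGraph.chosen f)).Reachable v w then
          ∏ e ∈ FeynmanGraph.chosen f, (MvPolynomial.X e : MvPolynomial (Fin nE) ℤ) else 0 := by
    intro f hf
    rw [Fintype.mem_piFinset] at hf
    rw [Matrix.det_flowMatrix (g := G.step f) hwR
      fun r hr => FeynmanGraph.step_of_mem (hf r) hr]
    simp only [FeynmanGraph.reachable_iff_iterate_step hf hwR]
    by_cases hreach : ∀ u, ∃ n, (G.step f)^[n] u ∈ R
    · have hflow : G.IsFlow R f := ⟨hf, hreach⟩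
      simp [hreach, hflow, hflow.prod_chosen]
    · rw [if_neg fun h => hreach h.1, if_neg fun h => hreach h.1.reach, mul_zero]
  rw [Finset.sum_congr rfl hdet, ← Finset.sum_filter]
  refine Finset.sum_bij (fun f _ => FeynmanGraph.chosen f) ?_ ?_ ?_ fun _ _ => rfl
  · intro f hf
    obtain ⟨-, hflow, hvw⟩ := Finset.mem_filter.1 hf
    exact Finset.mem_filter.2 ⟨Finset.mem_univ _,
      (FeynmanGraph.isForest_qPart_iff v.2 w.2).2 ⟨hflow.isRooted, hvw⟩⟩
  · intro f hf f' hf' h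
    exact (Finset.mem_filter.1 hf).2.1.eq_of_chosen_eq (Finset.mem_filter.1 hf').2.1 h
  · intro F hF
    obtain ⟨hroot, hvw⟩ :=
      (FeynmanGraph.isForest_qPart_iff v.2 w.2).1 (Finset.mem_filter.1 hF).2
    obtain ⟨f, hflow, rfl⟩ := hroot.exists_isFlow
    exact ⟨f, Finset.mem_filter.2
      ⟨Fintype.mem_piFinset.2 hflow.mem_options, hflow, hvw⟩, rfl⟩
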